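/- Let A be a real number in (0,1) satisfying (A+1)·A^{-1/(A+1)} = e. Then for every real number a with A < a ≤ e, the number a is suitable: every sign sequence represents an element of EReal, and every element of EReal is representable. In particular this holds for a = 1 (the initial problem). -/

import Mathlib

open Filter Topology

/-- Exponential on the extended real line, with e^{-∞}=0 and e^{+∞}=+∞. -/
noncomputable def eexp (y : EReal) : EReal :=
  if y = ⊥ then (0 : EReal) else if y = ⊤ then ⊤ else ((Real.exp y.toReal : ℝ) : EReal)

/-- `fSgn a s` is `f₊ : x ↦ e^{a·x}` when `s = true` and `f₋ : x ↦ -e^{a·x}` when `s = false`. -/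
noncomputable def fSgn (a : ℝ) (s : Bool) (x : EReal) : EReal :=
  if s then eexp ((a : EReal) * x) else -eexp ((a : EReal) * x)

/-- `uSeq a n ε = f_{ε₁}(f_{ε₂}(⋯ f_{ε_n}(1)⋯))`, where `ε (k-1)` is the k-th sign. -/
noncomputable def uSeq (a : ℝ) : ℕ → (ℕ → Bool) → EReal
  | 0, _ => 1
  | n + 1, ε => fSgn a (ε 0) (uSeq a n (fun k => ε (k + 1)))

/-- `ε` represents `t` if `(u_{n,ε})_n` tends to `t` in `EReal`. -/
def Represents (a : ℝ) (ε : ℕ → Bool) (t : EReal) : Prop :=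
  Filter.Tendsto (fun n => uSeq a n ε) Filter.atTop (nhds t)

/-- `t` is representable if some sign sequence represents it. -/
def Representable (a : ℝ) (t : EReal) : Prop :=
  ∃ ε : ℕ → Bool, Represents a ε t

/-- For a finite word `γ = γ₁⋯γ_k`, `fWord a γ = f_{γ₁} ∘ ⋯ ∘ f_{γ_k}`. -/
noncomputable def fWord (a : ℝ) (γ : List Bool) (x : EReal) : EReal :=
  γ.foldr (fSgn a) x

/-- `I(ε) = ⋂ₙ I(n,ε)` where `I(n,ε)` is the image of `EReal` under `f_{ε₁} ∘ ⋯ ∘ f_{ε_n}`. -/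
noncomputable def Iset (a : ℝ) (ε : ℕ → Bool) : Set EReal :=
  ⋂ n : ℕ, Set.range (fWord a (List.ofFn fun i : Fin n => ε i))

/-- `X` is the union over all finite words `γ` of the images `f_γ(]m,+∞])`. -/
noncomputable def Xset (a m : ℝ) : Set EReal :=
  ⋃ γ : List Bool, fWord a γ '' Set.Ioi (m : EReal)
/-- `A > 1/e`, in logarithmic form. -/
lemma log_A_gt (A : ℝ) (hA : A ∈ Set.Ioo (0 : ℝ) 1)
    (hAeq : (A + 1) * Real.rpow A (-1 / (A + 1)) = Real.exp 1) : -1 < Real.log A := by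
  obtain ⟨h0, h1⟩ := hA
  by_contra hcon
  push Not at hcon
  have hlog : Real.log (A + 1) + (-1 / (A + 1)) * Real.log A = 1 := by
    have h := congrArg Real.log hAeq
    have hp : 0 < Real.rpow A (-1 / (A + 1)) := Real.rpow_pos_of_pos h0 _
    have hr : Real.log (Real.rpow A (-1 / (A + 1))) = (-1 / (A + 1)) * Real.log A :=
      Real.log_rpow h0 _
    rw [Real.log_mul (by positivity) hp.ne', hr, Real.log_exp] at h
    exact h
  have h2 : Real.log (A + 1)⁻¹ < (A + 1)⁻¹ - 1 := by
    apply Real.log_lt_sub_one_of_pos (by positivity)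
    intro h
    have h' : A + 1 = 1 := inv_eq_one.1 h
    linarith
  rw [Real.log_inv] at h2
  have h3 : (A + 1)⁻¹ ≤ (-1 / (A + 1)) * Real.log A := by
    have : (-1 / (A + 1)) * Real.log A = (A + 1)⁻¹ * (- Real.log A) := by ring
    rw [this]
    have hi : 0 < (A + 1)⁻¹ := by positivity
    nlinarith
  linarith

/-- comparison of increments from comparison of derivatives -/
lemma incr_le {F G : ℝ → ℝ} {F' G' : ℝ → ℝ} {u v : ℝ} (huv : u ≤ v)
    (hF : ∀ x ∈ Set.Icc u v, HasDerivAt F (F' x) x)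
    (hG : ∀ x ∈ Set.Icc u v, HasDerivAt G (G' x) x)
    (hle : ∀ x ∈ Set.Icc u v, F' x ≤ G' x) : F v - F u ≤ G v - G u := by
  have hm : MonotoneOn (fun x => G x - F x) (Set.Icc u v) := by
    apply monotoneOn_of_hasDerivWithinAt_nonneg (f' := fun x => G' x - F' x) (convex_Icc u v)
    · intro x hx
      exact ((hG x hx).sub (hF x hx)).continuousAt.continuousWithinAt
    · intro x hx
      have hx' := interior_subset hx
      exact ((hG x hx').sub (hF x hx')).hasDerivWithinAt
    · intro x hx
      have := hle x (interior_subset hx)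
      linarith
  have := hm (Set.left_mem_Icc.2 huv) (Set.right_mem_Icc.2 huv) huv
  simp only at this
  linarith

/-- gap function derivative bound: `(x-1/e)²/9·e²`-type lower bound. -/
lemma gap_bound {a x : ℝ} (hae : a ≤ Real.exp 1) (hx : 0 < x) (hx1 : x < 1) :
    (x - Real.exp (-1)) ^ 2 / 9 ≤ 1 + a * (x * Real.log x) := by
  have hl : Real.log x < 0 := Real.log_neg hx hx1
  have h1 : 1 + Real.exp 1 * (x * Real.log x) ≤ 1 + a * (x * Real.log x) := by
    have : x * Real.log x ≤ 0 := by nlinarith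
    nlinarith
  refine le_trans ?_ h1
  have hE : 0 < Real.exp 1 := Real.exp_pos 1
  have he3 : Real.exp 1 < 3 := by have := Real.exp_one_lt_d9; linarith
  have he2 : 2.7 < Real.exp 1 := by have := Real.exp_one_gt_d9; linarith
  set E := Real.exp 1 with hEdef
  set r := Real.sqrt (E * x) with hr
  have hr0 : 0 < r := Real.sqrt_pos.2 (by positivity)
  have hr2 : r ^ 2 = E * x := Real.sq_sqrt (by positivity)
  have hlr : Real.log x = 2 * Real.log r - 1 := by
    have : Real.log (r ^ 2) = 1 + Real.log x := by
      rw [hr2, Real.log_mul hE.ne' hx.ne', hEdef, Real.log_exp]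
    rw [Real.log_pow] at this
    push_cast at this
    linarith
  have hlr2 : 1 - r⁻¹ ≤ Real.log r := Real.one_sub_inv_le_log_of_pos hr0
  have h2 : (1 - r) ^ 2 ≤ 1 + E * (x * Real.log x) := by
    have h3 : E * (x * Real.log x) = r ^ 2 * (2 * Real.log r - 1) := by rw [hr2, hlr]; ring
    rw [h3]
    have h4 : r ^ 2 * (1 - r⁻¹) ≤ r ^ 2 * Real.log r := by gcongr
    have h5 : r ^ 2 * (1 - r⁻¹) = r ^ 2 - r := by field_simp
    nlinarith
  refine le_trans ?_ h2
  have hx' : x = r ^ 2 * Real.exp (-1) := by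
    rw [hr2, Real.exp_neg, ← hEdef]; field_simp
  have hi : Real.exp (-1) ≤ 1 := by
    rw [Real.exp_le_one_iff]; norm_num
  have hi0 := Real.exp_pos (-1)
  have hr3 : r < 2 := by nlinarith
  have : x - Real.exp (-1) = Real.exp (-1) * (r - 1) * (r + 1) := by rw [hx']; ring
  rw [this]
  have h6 : (Real.exp (-1) * (r - 1) * (r + 1)) ^ 2 = (1 - r) ^ 2 * (Real.exp (-1) * (r + 1)) ^ 2 := by
    ring
  rw [h6]
  have h7 : (Real.exp (-1) * (r + 1)) ^ 2 ≤ 9 := by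
    have : Real.exp (-1) * (r + 1) ≤ 3 := by nlinarith
    have h8 : 0 ≤ Real.exp (-1) * (r + 1) := by positivity
    nlinarith
  nlinarith [sq_nonneg (1 - r)]

/-- the weight structure on `(1,∞)` -/
structure GoodWeight (a : ℝ) (φ ρ : ℝ → ℝ) : Prop where
  deriv : ∀ s, 1 < s → HasDerivAt φ (ρ s) s
  h2 : ∀ s, 1 < s → 5 / 4 * a ≤ ρ s * (Real.exp (a * s) + a)
  h3 : ∀ s, 1 < s → Real.log s ≤ a → a * s * ρ s * (1 + Real.log s) ≤ 1
  h4 : ∀ s, 1 < s → a < Real.log s → a * s * ρ s ≤ ρ (Real.log s / a)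

lemma exp_ge_e_mul (t : ℝ) : Real.exp 1 * t ≤ Real.exp t := by
  have h := Real.add_one_le_exp (t - 1)
  have : Real.exp t = Real.exp 1 * Real.exp (t - 1) := by rw [← Real.exp_add]; ring_nf
  rw [this]
  have := Real.exp_pos 1
  nlinarith

lemma goodWeight_ge_one {a : ℝ} (ha : 1 ≤ a) :
    GoodWeight a (fun s => -(a * s)⁻¹) (fun s => (a * s ^ 2)⁻¹) := by
  have ha0 : 0 < a := by linarith
  have he2 : 2.7 < Real.exp 1 := by have := Real.exp_one_gt_d9; linarith
  refine ⟨?_, ?_, ?_, ?_⟩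
  · intro s hs
    have hs0 : 0 < s := by linarith
    have h := ((hasDerivAt_id s).const_mul a).inv (by simp; constructor <;> positivity)
    refine h.neg.congr_deriv ?_
    simp only [id]
    field_simp
  · intro s hs
    have hs0 : 0 < s := by linarith
    have h1 := exp_ge_e_mul (a * s / 2)
    have h2 : Real.exp (a * s) = Real.exp (a * s / 2) ^ 2 := by
      rw [← Real.exp_nat_mul]; congr 1; push_cast; ring
    have ht : 0 < a * s := by positivity
    have h3 : 5 / 4 * (a * s) ^ 2 ≤ Real.exp (a * s) := by
      rw [h2]
      have h4 : 2.7 * (a * s / 2) ≤ Real.exp (a * s / 2) := by nlinarith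
      have : (2.7 * (a * s / 2)) ^ 2 ≤ Real.exp (a * s / 2) ^ 2 := by gcongr
      nlinarith
    rw [inv_mul_eq_div, le_div_iff₀ (by positivity)]
    nlinarith
  · intro s hs _
    have hs0 : 0 < s := by linarith
    have := Real.log_le_sub_one_of_pos hs0
    have h : a * s * (a * s ^ 2)⁻¹ * (1 + Real.log s) = (1 + Real.log s) / s := by field_simp
    rw [h, div_le_one hs0]; linarith
  · intro s hs hl
    have hs0 : 0 < s := by linarith
    have hl0 : 0 < Real.log s := Real.log_pos hs
    have h : a * s * (a * s ^ 2)⁻¹ = 1 / s := by field_simp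
    have h' : (a * (Real.log s / a) ^ 2)⁻¹ = a / Real.log s ^ 2 := by field_simp
    simp only [h, h']
    rw [div_le_div_iff₀ hs0 (by positivity)]
    have h1 := exp_ge_e_mul (Real.log s / 2)
    have h2 : s = Real.exp (Real.log s / 2) ^ 2 := by
      rw [← Real.exp_nat_mul]; push_cast
      rw [mul_div_cancel₀ _ (by norm_num), Real.exp_log hs0]
    have h4 : Real.log s ≤ Real.exp (Real.log s / 2) := by nlinarith
    have : Real.log s ^ 2 ≤ Real.exp (Real.log s / 2) ^ 2 := by gcongr
    nlinarith

lemma w_pos {a s : ℝ} (ha0 : 0 < a) (hs : 0 < s) :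
    1 + Real.log a ≤ a * s - Real.log s := by
  have := Real.log_le_sub_one_of_pos (mul_pos ha0 hs)
  rw [Real.log_mul ha0.ne' hs.ne'] at this
  linarith

lemma goodWeight_le_one {a : ℝ} (ha0 : 0 < a) (hla : -1 < Real.log a) (ha : a ≤ 1) :
    ∃ φ ρ, GoodWeight a φ ρ := by
  have he2 : 2.7 < Real.exp 1 := by have := Real.exp_one_gt_d9; linarith
  let ρ : ℝ → ℝ := fun s => a / (2 * (max s 1 * (a * max s 1 - Real.log (max s 1))))
  have hm : ∀ s : ℝ, 0 < max s 1 := fun s => lt_of_lt_of_le one_pos (le_max_right _ _)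
  have hρ : ∀ s, 1 < s → ρ s = a / (2 * (s * (a * s - Real.log s))) := by
    intro s hs
    simp only [ρ, max_eq_left hs.le]
  have hc : Continuous ρ := by
    have h1 : Continuous fun s : ℝ => max s 1 := by fun_prop
    have h2 : Continuous fun s : ℝ => Real.log (max s 1) := h1.log (fun s => (hm s).ne')
    refine continuous_const.div (by fun_prop) ?_
    intro s
    have := w_pos ha0 (hm s)
    have h3 : 0 < a * max s 1 - Real.log (max s 1) := by linarith
    have := hm s
    positivity
  refine ⟨fun s => ∫ x in (1 : ℝ)..s, ρ x, ρ, ?_, ?_, ?_, ?_⟩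
  · intro s _
    exact (hc.integral_hasStrictDerivAt 1 s).hasDerivAt
  · intro s hs
    have hs0 : 0 < s := by linarith
    have hw : 0 < a * s - Real.log s := by have := w_pos ha0 hs0; linarith
    rw [hρ s hs, div_mul_eq_mul_div a, le_div_iff₀ (by positivity)]
    have h1 := exp_ge_e_mul (a * s - Real.log s)
    rw [Real.exp_sub, Real.exp_log hs0, le_div_iff₀ hs0] at h1
    have h5 : 2.7 * (s * (a * s - Real.log s)) ≤ Real.exp (a * s) := by
      have : 0 < s * (a * s - Real.log s) := by positivity
      nlinarith
    have h6 : 0 < s * (a * s - Real.log s) := by positivity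
    nlinarith
  · intro s hs hl
    have hs0 : 0 < s := by linarith
    have hw : 0 < a * s - Real.log s := by have := w_pos ha0 hs0; linarith
    have hl0 : 0 < Real.log s := Real.log_pos hs
    rw [hρ s hs]
    have h : a * s * (a / (2 * (s * (a * s - Real.log s)))) * (1 + Real.log s)
      = a ^ 2 * (1 + Real.log s) / (2 * (a * s - Real.log s)) := by field_simp
    rw [h, div_le_one (by positivity)]
    have h1 := Real.add_one_le_exp (Real.log s)
    rw [Real.exp_log hs0] at h1
    nlinarith [mul_nonneg ha0.le (sub_nonneg.2 h1), mul_nonneg (sub_nonneg.2 hl) (sub_nonneg.2 ha),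
      mul_nonneg (mul_nonneg (sub_nonneg.2 hl) ha0.le) ha0.le, mul_nonneg (sub_nonneg.2 ha) (mul_nonneg ha0.le ha0.le)]
  · intro s hs hl
    have hs0 : 0 < s := by linarith
    have hl0 : 0 < Real.log s := Real.log_pos hs
    have hs1 : 1 < Real.log s / a := by rwa [lt_div_iff₀ ha0, one_mul]
    have hs10 : 0 < Real.log s / a := by linarith
    have hw : 0 < a * s - Real.log s := by have := w_pos ha0 hs0; linarith
    have hw1 : 0 < a * (Real.log s / a) - Real.log (Real.log s / a) := by
      have := w_pos ha0 hs10; linarith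
    rw [hρ s hs, hρ _ hs1]
    have h : a * s * (a / (2 * (s * (a * s - Real.log s))))
      = a ^ 2 / (2 * (a * s - Real.log s)) := by field_simp
    rw [h, div_le_div_iff₀ (by positivity) (by positivity)]
    have hq : 0 < s / (Real.log s / a) := by positivity
    have h7 := Real.log_le_sub_one_of_pos hq
    rw [Real.log_div hs0.ne' hs10.ne'] at h7
    set s' := Real.log s / a with hs'
    have h8 : Real.log s = a * s' := by rw [hs']; field_simp
    rw [h8] at h7 ⊢
    rw [h8] at hw
    have h9 : (a * s' - Real.log s') * s' ≤ s - s' := by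
      have : (s / s' - 1) * s' = s - s' := by field_simp
      rw [← this]; gcongr
    have ha2 : 0 < a ^ 2 := by positivity
    nlinarith

lemma exists_goodWeight {a : ℝ} (ha0 : 0 < a) (hla : -1 < Real.log a) :
    ∃ φ ρ, GoodWeight a φ ρ := by
  rcases le_total a 1 with h | h
  · exact goodWeight_le_one ha0 hla h
  · exact ⟨_, _, goodWeight_ge_one h⟩

/-- the coordinate on `(0,1)` -/
noncomputable def Lfun (a x : ℝ) : ℝ := Real.log (1 + a * x) / a

lemma Lfun_deriv {a x : ℝ} (ha : 0 < a) (hx : 0 < x) :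
    HasDerivAt (Lfun a) (1 / (1 + a * x)) x := by
  have h1 : HasDerivAt (fun x : ℝ => 1 + a * x) a x := by
    simpa using ((hasDerivAt_id x).const_mul a).const_add 1
  have h2 := (h1.log (by positivity)).div_const a
  refine h2.congr_deriv ?_
  field_simp

lemma cube_bound (u v c : ℝ) (huv : u ≤ v) :
    (v - u) ^ 3 / 12 ≤ (v - c) ^ 3 / 3 - (u - c) ^ 3 / 3 := by
  nlinarith [mul_nonneg (sub_nonneg.2 huv) (sq_nonneg ((v - c) + (u - c)))]

lemma cube_deriv (K c x : ℝ) : HasDerivAt (fun x => K * ((x - c) ^ 3 / 3)) (K * (x - c) ^ 2) x := by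
  have h := ((((hasDerivAt_id x).sub_const c).pow 3).div_const 3).const_mul K
  refine h.congr_deriv ?_
  simp

lemma S_neg_deriv {a x : ℝ} (hx : 0 < x) :
    HasDerivAt (fun x => -Real.log x / a) (-(1 / (a * x))) x := by
  have h := (Real.hasDerivAt_log hx.ne').neg.div_const a
  refine h.congr_deriv ?_
  field_simp

lemma S_pos_deriv {a x : ℝ} (hx : 0 < x) :
    HasDerivAt (fun x => Real.log x / a) (1 / (a * x)) x := by
  have h := (Real.hasDerivAt_log hx.ne').div_const a
  refine h.congr_deriv ?_
  field_simp

lemma step_i {a u v : ℝ} (ha : 0 < a) (hae : a ≤ Real.exp 1) (hu : 0 < u) (huv : u ≤ v) (hv : v < 1) :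
    Lfun a v - Lfun a u + (1 / (18 * a * (1 + a))) * ((v - u) ^ 3 / 12) ≤
      Lfun a (-Real.log u / a) - Lfun a (-Real.log v / a) := by
  set K := 1 / (18 * a * (1 + a)) with hK
  have hK0 : 0 < K := by positivity
  have h := incr_le (F := fun x => Lfun a x + K * ((x - Real.exp (-1)) ^ 3 / 3))
    (G := fun x => -Lfun a (-Real.log x / a)) (F' := fun x => 1 / (1 + a * x) + K * (x - Real.exp (-1)) ^ 2)
    (G' := fun x => -(1 / (1 + a * (-Real.log x / a)) * (-(1 / (a * x))))) huv ?_ ?_ ?_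
  · have h2 := cube_bound u v (Real.exp (-1)) huv
    have h3 := mul_le_mul_of_nonneg_left h2 hK0.le
    linarith
  · intro x hx
    exact (Lfun_deriv ha (lt_of_lt_of_le hu hx.1)).add (cube_deriv _ _ _)
  · intro x hx
    have hx0 : 0 < x := lt_of_lt_of_le hu hx.1
    have hl : Real.log x < 0 := Real.log_neg hx0 (lt_of_le_of_lt hx.2 hv)
    have hs : 0 < -Real.log x / a := div_pos (by linarith) ha
    exact ((Lfun_deriv ha hs).comp x (S_neg_deriv hx0)).neg
  · intro x hx
    have hx0 : 0 < x := lt_of_lt_of_le hu hx.1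
    have hx1 : x < 1 := lt_of_le_of_lt hx.2 hv
    have hl : Real.log x < 0 := Real.log_neg hx0 hx1
    have hg := gap_bound hae hx0 hx1
    have e1 : a * (-Real.log x / a) = -Real.log x := by field_simp
    simp only [e1]
    set l := -Real.log x with hldef
    have hl0 : 0 < l := by linarith
    have hxl : x * (1 + l) ≤ 1 := by
      have := Real.log_le_sub_one_of_pos (inv_pos.2 hx0)
      rw [Real.log_inv] at this
      have h3 : x * (1 + l) ≤ x * x⁻¹ := by gcongr; linarith
      rwa [mul_inv_cancel₀ hx0.ne'] at h3
    have e2 : -(1 / (1 + l) * -(1 / (a * x))) - 1 / (1 + a * x)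
        = (1 + a * (x * Real.log x)) / (a * (x * (1 + l)) * (1 + a * x)) := by
      have : Real.log x = -l := by rw [hldef]; ring
      rw [this]; field_simp; ring
    have h5 : (x - Real.exp (-1)) ^ 2 / 9 / (a * (1 + a)) ≤
        (1 + a * (x * Real.log x)) / (a * (x * (1 + l)) * (1 + a * x)) := by
      have hden : a * (x * (1 + l)) * (1 + a * x) ≤ a * (1 + a) := by
        have : a * (x * (1 + l)) ≤ a := by nlinarith
        have h6 : 1 + a * x ≤ 1 + a := by nlinarith
        gcongr
      have h0 : 0 ≤ (x - Real.exp (-1)) ^ 2 / 9 := by positivity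
      have h00 := h0.trans hg
      gcongr
    have h6 : K * (x - Real.exp (-1)) ^ 2 ≤ (x - Real.exp (-1)) ^ 2 / 9 / (a * (1 + a)) := by
      have e : (x - Real.exp (-1)) ^ 2 / 9 / (a * (1 + a)) = 2 * K * (x - Real.exp (-1)) ^ 2 := by
        rw [hK]; field_simp; ring
      rw [e]
      have := mul_nonneg hK0.le (sq_nonneg (x - Real.exp (-1)))
      linarith
    linarith

lemma step_ii {a u v : ℝ} {φ ρ : ℝ → ℝ} (hw : GoodWeight a φ ρ) (ha : 1 / 3 < a)
    (hu : 0 < u) (huv : u ≤ v) (hv : v < 1) (hva : a < -Real.log v) :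
    Lfun a v - Lfun a u + (1 / (18 * a * (1 + a))) * ((v - u) ^ 3 / 12) ≤
      φ (-Real.log u / a) - φ (-Real.log v / a) := by
  have ha0 : 0 < a := by linarith
  set K := 1 / (18 * a * (1 + a)) with hK
  have hK0 : 0 < K := by positivity
  have h := incr_le (F := fun x => Lfun a x + K * ((x - Real.exp (-1)) ^ 3 / 3))
    (G := fun x => -φ (-Real.log x / a)) (F' := fun x => 1 / (1 + a * x) + K * (x - Real.exp (-1)) ^ 2)
    (G' := fun x => -(ρ (-Real.log x / a) * (-(1 / (a * x))))) huv ?_ ?_ ?_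
  · have h2 := cube_bound u v (Real.exp (-1)) huv
    have h3 := mul_le_mul_of_nonneg_left h2 hK0.le
    linarith
  · intro x hx
    exact (Lfun_deriv ha0 (lt_of_lt_of_le hu hx.1)).add (cube_deriv _ _ _)
  · intro x hx
    have hx0 : 0 < x := lt_of_lt_of_le hu hx.1
    have hl : Real.log x ≤ Real.log v := Real.log_le_log hx0 hx.2
    have hs : 1 < -Real.log x / a := by rw [lt_div_iff₀ ha0]; linarith
    exact ((hw.deriv _ hs).comp x (S_neg_deriv hx0)).neg
  · intro x hx
    have hx0 : 0 < x := lt_of_lt_of_le hu hx.1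
    have hx1 : x < 1 := lt_of_le_of_lt hx.2 hv
    have hl : Real.log x ≤ Real.log v := Real.log_le_log hx0 hx.2
    have hs : 1 < -Real.log x / a := by rw [lt_div_iff₀ ha0]; linarith
    have h2 := hw.h2 _ hs
    have e1 : a * (-Real.log x / a) = -Real.log x := by field_simp
    rw [e1, Real.exp_neg, Real.exp_log hx0] at h2
    set r := ρ (-Real.log x / a)
    have h3 : 5 / 4 * (1 / (1 + a * x)) ≤ -(r * -(1 / (a * x))) := by
      have : -(r * -(1 / (a * x))) = r / (a * x) := by ring
      rw [this, mul_one_div, div_le_div_iff₀ (by positivity) (by positivity)]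
      have h4 := mul_le_mul_of_nonneg_left h2 hx0.le
      have e : x * (r * (x⁻¹ + a)) = r * (1 + a * x) := by field_simp
      rw [e] at h4
      linarith
    have h7 : K * (x - Real.exp (-1)) ^ 2 ≤ 1 / 4 * (1 / (1 + a * x)) := by
      have hi : Real.exp (-1) ≤ 1 := by
        rw [Real.exp_le_one_iff]; norm_num
      have hi0 := Real.exp_pos (-1)
      have h8 : (x - Real.exp (-1)) ^ 2 ≤ 1 := by
        rw [sq_le_one_iff_abs_le_one, abs_le]; constructor <;> linarith
      have h9 : K ≤ 1 / 4 * (1 / (1 + a)) := by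
        rw [hK, mul_one_div, div_le_div_iff₀ (by positivity) (by positivity)]
        nlinarith
      have h10 : 1 / (1 + a) ≤ 1 / (1 + a * x) := by
        apply one_div_le_one_div_of_le (by positivity); nlinarith
      nlinarith
    linarith

lemma step_iii {a u v : ℝ} {φ ρ : ℝ → ℝ} (hw : GoodWeight a φ ρ) (ha0 : 0 < a)
    (hu : 1 < u) (huv : u ≤ v) (hva : Real.log v < a) :
    φ v - φ u ≤ Lfun a (Real.log v / a) - Lfun a (Real.log u / a) := by
  refine incr_le (F := φ) (F' := ρ)
    (G := fun x => Lfun a (Real.log x / a))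
    (G' := fun x => (1 / (1 + a * (Real.log x / a))) * (1 / (a * x))) huv ?_ ?_ ?_
  · intro x hx
    exact hw.deriv _ (lt_of_lt_of_le hu hx.1)
  · intro x hx
    have hx1 : 1 < x := lt_of_lt_of_le hu hx.1
    have hs : 0 < Real.log x / a := div_pos (Real.log_pos hx1) ha0
    exact (Lfun_deriv ha0 hs).comp x (S_pos_deriv (by linarith))
  · intro x hx
    have hx1 : 1 < x := lt_of_lt_of_le hu hx.1
    have hx0 : 0 < x := by linarith
    have hl : Real.log x ≤ Real.log v := Real.log_le_log hx0 hx.2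
    have hl0 := Real.log_pos hx1
    have h3 := hw.h3 x hx1 (by linarith)
    have e1 : a * (Real.log x / a) = Real.log x := by field_simp
    simp only [e1]
    rw [div_mul_div_comm, le_div_iff₀ (by positivity)]
    linarith

lemma step_iv {a u v : ℝ} {φ ρ : ℝ → ℝ} (hw : GoodWeight a φ ρ) (ha0 : 0 < a)
    (hu : 1 < u) (huv : u ≤ v) (hva : a < Real.log u) :
    φ v - φ u ≤ φ (Real.log v / a) - φ (Real.log u / a) := by
  refine incr_le (F := φ) (F' := ρ)
    (G := fun x => φ (Real.log x / a))
    (G' := fun x => ρ (Real.log x / a) * (1 / (a * x))) huv ?_ ?_ ?_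
  · intro x hx
    exact hw.deriv _ (lt_of_lt_of_le hu hx.1)
  · intro x hx
    have hx1 : 1 < x := lt_of_lt_of_le hu hx.1
    have hl : Real.log u ≤ Real.log x := Real.log_le_log (by linarith) hx.1
    have hs : 1 < Real.log x / a := by rw [lt_div_iff₀ ha0]; linarith
    exact (hw.deriv _ hs).comp x (S_pos_deriv (by linarith))
  · intro x hx
    have hx1 : 1 < x := lt_of_lt_of_le hu hx.1
    have hx0 : 0 < x := by linarith
    have hl : Real.log u ≤ Real.log x := Real.log_le_log (by linarith) hx.1
    have h3 := hw.h4 x hx1 (by linarith)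
    rw [mul_one_div, le_div_iff₀ (by positivity)]
    linarith

lemma φ_mono {a u v : ℝ} {φ ρ : ℝ → ℝ} (hw : GoodWeight a φ ρ) (ha0 : 0 < a)
    (hu : 1 < u) (huv : u ≤ v) : 0 ≤ φ v - φ u := by
  have := incr_le (F := fun _ => (0 : ℝ)) (F' := fun _ => 0) (G := φ) (G' := ρ) huv
    (fun x _ => hasDerivAt_const _ _) (fun x hx => hw.deriv _ (lt_of_lt_of_le hu hx.1)) ?_
  · simpa using this
  · intro x hx
    have h2 := hw.h2 x (lt_of_lt_of_le hu hx.1)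
    have h3 : 0 < Real.exp (a * x) + a := by positivity
    by_contra hc
    push Not at hc
    nlinarith

lemma L_mono {a u v : ℝ} (ha0 : 0 < a) (hu : 0 < u) (huv : u ≤ v) :
    0 ≤ Lfun a v - Lfun a u := by
  have := incr_le (F := fun _ => (0 : ℝ)) (F' := fun _ => 0) (G := Lfun a)
    (G' := fun x => 1 / (1 + a * x)) huv
    (fun x _ => hasDerivAt_const _ _) (fun x hx => Lfun_deriv ha0 (lt_of_lt_of_le hu hx.1)) ?_
  · simpa using this
  · intro x hx
    have : 0 < x := lt_of_lt_of_le hu hx.1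
    positivity

lemma L_lip {a u v : ℝ} (ha0 : 0 < a) (hu : 0 < u) (huv : u ≤ v) :
    Lfun a v - Lfun a u ≤ v - u := by
  refine incr_le (F := Lfun a) (F' := fun x => 1 / (1 + a * x)) (G := fun x => x)
    (G' := fun _ => 1) huv
    (fun x hx => Lfun_deriv ha0 (lt_of_lt_of_le hu hx.1)) (fun x hx => hasDerivAt_id x) ?_
  intro x hx
  have : 0 < x := lt_of_lt_of_le hu hx.1
  rw [div_le_one (by positivity)]
  nlinarith

/-- the global coordinate -/
noncomputable def Phi (a : ℝ) (φ : ℝ → ℝ) (x : ℝ) : ℝ := if x < 1 then Lfun a x else φ x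

def SameSide (x y : ℝ) : Prop := (x < 1 ∧ y < 1) ∨ (1 < x ∧ 1 < y)

/-- one-step expansion -/
lemma step_main {a : ℝ} {φ ρ : ℝ → ℝ} (hw : GoodWeight a φ ρ) (ha : 1 / 3 < a)
    (hae : a ≤ Real.exp 1) {u v : ℝ} (hu : 0 < u) (huv : u ≤ v) (h1 : SameSide u v)
    (h2 : SameSide (|Real.log u| / a) (|Real.log v| / a)) :
    |Phi a φ u - Phi a φ v| + (if u < 1 then (1 / (216 * a * (1 + a))) * |u - v| ^ 3 else 0) ≤
      |Phi a φ (|Real.log u| / a) - Phi a φ (|Real.log v| / a)| := by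
  have ha0 : 0 < a := by linarith
  have hcst : (1 / (216 * a * (1 + a))) * |u - v| ^ 3 =
      (1 / (18 * a * (1 + a))) * ((v - u) ^ 3 / 12) := by
    rw [abs_sub_comm, abs_of_nonneg (by linarith)]; field_simp; ring
  rw [hcst]
  rcases h1 with ⟨h1u, h1v⟩ | ⟨h1u, h1v⟩
  · have lu : |Real.log u| = -Real.log u := abs_of_neg (Real.log_neg hu h1u)
    have lv : |Real.log v| = -Real.log v := abs_of_neg (Real.log_neg (by linarith) h1v)
    have hL := L_mono ha0 hu huv
    have e : |Phi a φ u - Phi a φ v| = Lfun a v - Lfun a u := by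
      rw [Phi, Phi, if_pos h1u, if_pos h1v, abs_sub_comm, abs_of_nonneg hL]
    rw [lu, lv] at h2 ⊢
    rw [e, if_pos h1u]
    rcases h2 with ⟨h2u, h2v⟩ | ⟨h2u, h2v⟩
    · rw [Phi, Phi, if_pos h2u, if_pos h2v]
      exact (step_i ha0 hae hu huv h1v).trans (le_abs_self _)
    · rw [Phi, Phi, if_neg h2u.not_gt, if_neg h2v.not_gt]
      rw [lt_div_iff₀ ha0, one_mul] at h2v
      exact (step_ii hw ha hu huv h1v h2v).trans (le_abs_self _)
  · have lu : |Real.log u| = Real.log u := abs_of_pos (Real.log_pos h1u)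
    have lv : |Real.log v| = Real.log v := abs_of_pos (Real.log_pos h1v)
    have hL := φ_mono hw ha0 h1u huv
    have e : |Phi a φ u - Phi a φ v| = φ v - φ u := by
      rw [Phi, Phi, if_neg h1u.not_gt, if_neg h1v.not_gt, abs_sub_comm, abs_of_nonneg hL]
    rw [lu, lv] at h2 ⊢
    rw [e, if_neg h1u.not_gt, add_zero, abs_sub_comm]
    rcases h2 with ⟨h2u, h2v⟩ | ⟨h2u, h2v⟩
    · rw [Phi, Phi, if_pos h2u, if_pos h2v]
      rw [div_lt_one ha0] at h2v
      exact (step_iii hw ha0 h1u huv h2v).trans (le_abs_self _)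
    · rw [Phi, Phi, if_neg h2u.not_gt, if_neg h2v.not_gt]
      rw [lt_div_iff₀ ha0, one_mul] at h2u
      exact (step_iv hw ha0 h1u huv h2u).trans (le_abs_self _)

lemma SameSide.symm {x y : ℝ} (h : SameSide x y) : SameSide y x := by
  rcases h with h | h
  · exact Or.inl h.symm
  · exact Or.inr h.symm

lemma step_main' {a : ℝ} {φ ρ : ℝ → ℝ} (hw : GoodWeight a φ ρ) (ha : 1 / 3 < a)
    (hae : a ≤ Real.exp 1) {u v : ℝ} (hu : 0 < u) (hv : 0 < v) (h1 : SameSide u v)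
    (h2 : SameSide (|Real.log u| / a) (|Real.log v| / a)) :
    |Phi a φ u - Phi a φ v| + (if u < 1 then (1 / (216 * a * (1 + a))) * |u - v| ^ 3 else 0) ≤
      |Phi a φ (|Real.log u| / a) - Phi a φ (|Real.log v| / a)| := by
  rcases le_total u v with h | h
  · exact step_main hw ha hae hu h h1 h2
  · have := step_main hw ha hae hv h h1.symm h2.symm
    have hiff : (v < 1) ↔ (u < 1) := by
      rcases h1 with h | h
      · exact ⟨fun _ => h.1, fun _ => h.2⟩
      · exact ⟨fun h' => absurd h' h.2.not_gt, fun h' => absurd h' h.1.not_gt⟩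
    simp only [hiff] at this
    rwa [abs_sub_comm (Phi a φ u), abs_sub_comm u, abs_sub_comm (Phi a φ (|Real.log u| / a))]

/-- returns to `(0,1)` -/
lemma returns {a : ℝ} (ha0 : 0 < a) (hla : -1 < Real.log a) (x : ℕ → ℝ) (hx : ∀ n, 0 < x n)
    (hne : ∀ n, x n ≠ 1)
    (hrec : ∀ n, x (n + 1) = |Real.log (x n)| / a) (N : ℕ) : ∃ n, N ≤ n ∧ x n < 1 := by
  by_contra hcon
  push Not at hcon
  have hgt : ∀ n, N ≤ n → 1 < x n := fun n hn => lt_of_le_of_ne (hcon n hn) (hne n).symm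
  set d := (1 + Real.log a) / a with hd
  have hd0 : 0 < d := div_pos (by linarith) ha0
  have hdec : ∀ n, N ≤ n → x (n + 1) ≤ x n - d := by
    intro n hn
    rw [hrec n, abs_of_pos (Real.log_pos (hgt n hn)), div_le_iff₀ ha0, sub_mul, hd,
      div_mul_cancel₀ _ ha0.ne']
    have := w_pos ha0 (hx n)
    linarith
  have hk : ∀ k : ℕ, x (N + k) ≤ x N - k * d := by
    intro k
    induction k with
    | zero => simp
    | succ k ih =>
      have := hdec (N + k) (by omega)
      rw [← add_assoc]; push_cast; linarith
  obtain ⟨k, hk'⟩ := exists_nat_gt (x N / d)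
  rw [div_lt_iff₀ hd0] at hk'
  have := hk k
  have := hx (N + k)
  linarith

lemma no_homterval {a : ℝ} (ha : 1 / 3 < a) (hla : -1 < Real.log a)
    (hae : a ≤ Real.exp 1) (x y : ℕ → ℝ) (hx : ∀ n, 0 < x n) (hy : ∀ n, 0 < y n)
    (hxr : ∀ n, x (n + 1) = |Real.log (x n)| / a) (hyr : ∀ n, y (n + 1) = |Real.log (y n)| / a)
    (hs : ∀ n, SameSide (x n) (y n)) (hxy : x 0 ≠ y 0) : False := by
  have ha0 : 0 < a := by linarith
  obtain ⟨φ, ρ, hw⟩ := exists_goodWeight ha0 hla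
  have hxy' : ∀ n, x n ≠ y n := by
    intro n
    induction n with
    | zero => exact hxy
    | succ n ih =>
      intro h
      apply ih
      rw [hxr, hyr, div_left_inj' ha0.ne'] at h
      apply Real.log_injOn_pos (hx n) (hy n)
      rcases hs n with ⟨h1, h2⟩ | ⟨h1, h2⟩
      · rw [abs_of_neg (Real.log_neg (hx n) h1), abs_of_neg (Real.log_neg (hy n) h2)] at h
        linarith
      · rwa [abs_of_pos (Real.log_pos h1), abs_of_pos (Real.log_pos h2)] at h
  have hret := returns ha0 hla x hx (fun n => by
    rcases hs n with h | h
    · exact h.1.ne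
    · exact h.1.ne') hxr
  set l : ℕ → ℝ := fun n => |Phi a φ (x n) - Phi a φ (y n)| with hl
  set c := 1 / (216 * a * (1 + a)) with hc
  have hc0 : 0 < c := by positivity
  have hstep : ∀ n, l n + (if x n < 1 then c * |x n - y n| ^ 3 else 0) ≤ l (n + 1) := by
    intro n
    have h2 := hs (n + 1)
    rw [hxr, hyr] at h2
    have := step_main' hw ha hae (hx n) (hy n) (hs n) h2
    rw [← hxr, ← hyr] at this
    exact this
  have hmono : Monotone l := by
    apply monotone_nat_of_le_succ
    intro n
    have := hstep n
    split_ifs at this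
    · have : 0 ≤ c * |x n - y n| ^ 3 := by positivity
      linarith
    · linarith
  have hside : ∀ n, x n < 1 → y n < 1 := by
    intro n h
    rcases hs n with h' | h'
    · exact h'.2
    · exact absurd h h'.1.not_gt
  have hlle : ∀ n, x n < 1 → l n ≤ |x n - y n| := by
    intro n h
    simp only [hl, Phi, if_pos h, if_pos (hside n h)]
    rcases le_total (x n) (y n) with h' | h'
    · rw [abs_sub_comm, abs_of_nonneg (L_mono ha0 (hx n) h'), abs_sub_comm,
        abs_of_nonneg (by linarith)]
      exact L_lip ha0 (hx n) h'
    · rw [abs_of_nonneg (L_mono ha0 (hy n) h'), abs_of_nonneg (by linarith)]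
      exact L_lip ha0 (hy n) h'
  have hle1 : ∀ n, x n < 1 → l n ≤ 1 := by
    intro n h
    refine (hlle n h).trans ?_
    have := hside n h
    have := hx n
    have := hy n
    rw [abs_le]; constructor <;> linarith
  obtain ⟨n0, -, hn0⟩ := hret 0
  have hpos : 0 < l (n0 + 1) := by
    have h := hstep n0
    rw [if_pos hn0] at h
    have h1 : 0 < |x n0 - y n0| := abs_pos.2 (sub_ne_zero.2 (hxy' n0))
    have h2 : 0 < c * |x n0 - y n0| ^ 3 := by positivity
    have h3 : 0 ≤ l n0 := abs_nonneg _
    linarith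
  set δ := c * l (n0 + 1) ^ 3 with hδ
  have hδ0 : 0 < δ := by positivity
  have hgrow : ∀ k : ℕ, ∃ n, n0 + 1 ≤ n ∧ k * δ ≤ l n := by
    intro k
    induction k with
    | zero => exact ⟨n0 + 1, le_rfl, by simpa using hpos.le⟩
    | succ k ih =>
      obtain ⟨n, hn, hk⟩ := ih
      obtain ⟨m, hm, hm1⟩ := hret n
      refine ⟨m + 1, by omega, ?_⟩
      have h := hstep m
      rw [if_pos hm1] at h
      have h1 : l (n0 + 1) ≤ |x m - y m| := (hmono (by omega)).trans (hlle m hm1)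
      have h2 : δ ≤ c * |x m - y m| ^ 3 := by rw [hδ]; gcongr
      have h3 := hmono hm
      push_cast; linarith
  obtain ⟨k, hk⟩ := exists_nat_gt (1 / δ)
  rw [div_lt_iff₀ hδ0] at hk
  obtain ⟨n, -, hn⟩ := hgrow k
  obtain ⟨m, hm, hm1⟩ := hret n
  have := hle1 m hm1
  have := hmono hm
  linarith

lemma eexp_bot {a : ℝ} (ha : 0 < a) : eexp ((a : EReal) * ⊥) = 0 := by
  rw [EReal.coe_mul_bot_of_pos ha, eexp, if_pos rfl]

lemma eexp_top {a : ℝ} (ha : 0 < a) : eexp ((a : EReal) * ⊤) = ⊤ := by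
  rw [EReal.coe_mul_top_of_pos ha, eexp, if_neg (by simp), if_pos rfl]

lemma eexp_coe (a x : ℝ) : eexp ((a : EReal) * (x : EReal)) = ((Real.exp (a * x) : ℝ) : EReal) := by
  rw [← EReal.coe_mul, eexp, if_neg (EReal.coe_ne_bot _), if_neg (EReal.coe_ne_top _),
    EReal.toReal_coe]

lemma eexp_nonneg {a : ℝ} (ha : 0 < a) (x : EReal) : 0 ≤ eexp ((a : EReal) * x) := by
  induction x with
  | bot => rw [eexp_bot ha]
  | top => rw [eexp_top ha]; exact le_top
  | coe x => rw [eexp_coe]; exact_mod_cast (Real.exp_pos _).le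

lemma eexp_surj {a : ℝ} (ha : 0 < a) (t : EReal) (ht : 0 ≤ t) :
    ∃ x, eexp ((a : EReal) * x) = t := by
  induction t with
  | bot => simp at ht
  | top => exact ⟨⊤, eexp_top ha⟩
  | coe t =>
    have ht' : 0 ≤ t := by exact_mod_cast ht
    rcases ht'.eq_or_lt with h | h
    · exact ⟨⊥, by rw [eexp_bot ha, ← h]; rfl⟩
    · refine ⟨((Real.log t / a : ℝ) : EReal), ?_⟩
      rw [eexp_coe, mul_div_cancel₀ _ ha.ne', Real.exp_log h]

lemma fSgn_surj {a : ℝ} (ha : 0 < a) (t : EReal) : ∃ s x, t = fSgn a s x := by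
  rcases le_total 0 t with h | h
  · obtain ⟨x, hx⟩ := eexp_surj ha t h
    exact ⟨true, x, by simp [fSgn, hx]⟩
  · obtain ⟨x, hx⟩ := eexp_surj ha (-t) (by simpa using h)
    exact ⟨false, x, by simp [fSgn, hx]⟩

lemma lt_of_eexp_lt {a : ℝ} (ha : 0 < a) {P : EReal} {p : ℝ}
    (h : eexp ((a : EReal) * P) < (p : EReal)) : 0 < p ∧ P < ((Real.log p / a : ℝ) : EReal) := by
  have hp : 0 < p := by
    have := (eexp_nonneg ha P).trans_lt h
    exact_mod_cast this
  refine ⟨hp, ?_⟩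
  induction P with
  | bot => exact EReal.bot_lt_coe _
  | top => rw [eexp_top ha] at h; simp at h
  | coe x =>
    rw [eexp_coe, EReal.coe_lt_coe_iff] at h
    rw [EReal.coe_lt_coe_iff, lt_div_iff₀ ha, mul_comm, Real.lt_log_iff_exp_lt hp]
    exact h

lemma lt_of_lt_eexp {a : ℝ} (ha : 0 < a) {Q : EReal} {p : ℝ} (hp : 0 < p)
    (h : (p : EReal) < eexp ((a : EReal) * Q)) : ((Real.log p / a : ℝ) : EReal) < Q := by
  induction Q with
  | bot =>
    rw [eexp_bot ha] at h
    have : p < 0 := by exact_mod_cast h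
    linarith
  | top => exact EReal.coe_lt_top _
  | coe x =>
    rw [eexp_coe, EReal.coe_lt_coe_iff] at h
    rw [EReal.coe_lt_coe_iff, div_lt_iff₀ ha, mul_comm, Real.log_lt_iff_lt_exp hp]
    exact h

/-- image of `EReal` under the first `n` maps -/
def Rset (a : ℝ) : ℕ → (ℕ → Bool) → Set EReal
  | 0, _ => Set.univ
  | n + 1, ε => fSgn a (ε 0) '' Rset a n (fun k => ε (k + 1))

lemma uSeq_mem (a : ℝ) (n : ℕ) : ∀ (ε : ℕ → Bool) (m : ℕ), n ≤ m → uSeq a m ε ∈ Rset a n ε := by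
  induction n with
  | zero => intro ε m _; exact Set.mem_univ _
  | succ n ih =>
    intro ε m hm
    obtain ⟨m, rfl⟩ : ∃ k, m = k + 1 := ⟨m - 1, by omega⟩
    exact ⟨_, ih _ m (by omega), rfl⟩

/-- `p, q` lie strictly between two points of each `Rset a n ε`. -/
def BtwR (a : ℝ) (ε : ℕ → Bool) (p q : ℝ) : Prop :=
  ∀ n, ∃ P ∈ Rset a n ε, ∃ Q ∈ Rset a n ε,
    P < (p : EReal) ∧ P < (q : EReal) ∧ (p : EReal) < Q ∧ (q : EReal) < Q

lemma BtwR.step {a : ℝ} (ha : 0 < a) {ε : ℕ → Bool} {p q : ℝ} (h : BtwR a ε p q) :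
    BtwR a (fun k => ε (k + 1)) (Real.log p / a) (Real.log q / a) ∧ 0 < p * q := by
  cases hε : ε 0 with
  | true =>
    have key : ∀ n, ∃ P ∈ Rset a n (fun k => ε (k + 1)), ∃ Q ∈ Rset a n (fun k => ε (k + 1)),
        (P < ((Real.log p / a : ℝ) : EReal) ∧ P < ((Real.log q / a : ℝ) : EReal) ∧
        ((Real.log p / a : ℝ) : EReal) < Q ∧ ((Real.log q / a : ℝ) : EReal) < Q) ∧ 0 < p * q := by
      intro n
      obtain ⟨P, ⟨P', hP', rfl⟩, Q, ⟨Q', hQ', rfl⟩, h1, h2, h3, h4⟩ := h (n + 1)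
      simp only [fSgn, hε, if_true] at h1 h2 h3 h4
      obtain ⟨hp, g1⟩ := lt_of_eexp_lt ha h1
      obtain ⟨hq, g2⟩ := lt_of_eexp_lt ha h2
      exact ⟨P', hP', Q', hQ', ⟨g1, g2, lt_of_lt_eexp ha hp h3, lt_of_lt_eexp ha hq h4⟩,
        mul_pos hp hq⟩
    refine ⟨fun n => ?_, ?_⟩
    · obtain ⟨P, hP, Q, hQ, hh, -⟩ := key n
      exact ⟨P, hP, Q, hQ, hh⟩
    · obtain ⟨P, hP, Q, hQ, -, hh⟩ := key 0
      exact hh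
  | false =>
    have key : ∀ n, ∃ P ∈ Rset a n (fun k => ε (k + 1)), ∃ Q ∈ Rset a n (fun k => ε (k + 1)),
        (P < ((Real.log p / a : ℝ) : EReal) ∧ P < ((Real.log q / a : ℝ) : EReal) ∧
        ((Real.log p / a : ℝ) : EReal) < Q ∧ ((Real.log q / a : ℝ) : EReal) < Q) ∧ 0 < p * q := by
      intro n
      obtain ⟨P, ⟨P', hP', rfl⟩, Q, ⟨Q', hQ', rfl⟩, h1, h2, h3, h4⟩ := h (n + 1)
      simp only [fSgn, hε, Bool.false_eq_true, if_false] at h1 h2 h3 h4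
      have h1' := EReal.neg_lt_comm.1 h1
      have h2' := EReal.neg_lt_comm.1 h2
      have h3' := EReal.lt_neg_comm.1 h3
      have h4' := EReal.lt_neg_comm.1 h4
      rw [← EReal.coe_neg] at h1' h2' h3' h4'
      obtain ⟨hp, g1⟩ := lt_of_eexp_lt ha h3'
      obtain ⟨hq, g2⟩ := lt_of_eexp_lt ha h4'
      have g3 := lt_of_lt_eexp ha hp h1'
      have g4 := lt_of_lt_eexp ha hq h2'
      rw [Real.log_neg_eq_log] at g1 g2 g3 g4
      exact ⟨Q', hQ', P', hP', ⟨g1, g2, g3, g4⟩, by nlinarith⟩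
    refine ⟨fun n => ?_, ?_⟩
    · obtain ⟨P, hP, Q, hQ, hh, -⟩ := key n
      exact ⟨P, hP, Q, hQ, hh⟩
    · obtain ⟨P, hP, Q, hQ, -, hh⟩ := key 0
      exact hh

lemma BtwR.false {a : ℝ} (ha : 1 / 3 < a) (hla : -1 < Real.log a)
    (hae : a ≤ Real.exp 1) {ε : ℕ → Bool} {p q : ℝ} (hpq : p < q) (h : BtwR a ε p q) : False := by
  have ha0 : 0 < a := by linarith
  let T : ℝ → ℝ := fun x => Real.log x / a
  have hT : ∀ n x, T^[n + 1] x = Real.log (T^[n] x) / a := by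
    intro n x
    rw [Function.iterate_succ_apply']
  have hB : ∀ n, BtwR a (fun k => ε (k + n)) (T^[n] p) (T^[n] q) := by
    intro n
    induction n with
    | zero => exact h
    | succ n ih =>
      have := (ih.step ha0).1
      rw [hT, hT]
      convert this using 2
      ring_nf
  have hpos : ∀ n, 0 < T^[n] p * T^[n] q := fun n => ((hB n).step ha0).2
  have hp : ∀ n, T^[n] p ≠ 0 := fun n h => by have := hpos n; simp [h] at this
  have hq : ∀ n, T^[n] q ≠ 0 := fun n h => by have := hpos n; simp [h] at this
  refine no_homterval ha hla hae (fun n => |T^[n] p|) (fun n => |T^[n] q|)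
    (fun n => abs_pos.2 (hp n)) (fun n => abs_pos.2 (hq n)) ?_ ?_ ?_ ?_
  · intro n
    simp only [hT, Real.log_abs, abs_div, abs_of_pos ha0]
  · intro n
    simp only [hT, Real.log_abs, abs_div, abs_of_pos ha0]
  · intro n
    have h1 := hpos (n + 1)
    rw [hT, hT, ← Real.log_abs (T^[n] p), ← Real.log_abs (T^[n] q)] at h1
    have h2 : 0 < Real.log |T^[n] p| * Real.log |T^[n] q| := by
      have e : Real.log |T^[n] p| * Real.log |T^[n] q| =
        (Real.log |T^[n] p| / a * (Real.log |T^[n] q| / a)) * (a * a) := by field_simp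
      rw [e]; positivity
    rcases mul_pos_iff.1 h2 with ⟨g1, g2⟩ | ⟨g1, g2⟩
    · right
      exact ⟨(Real.log_pos_iff (abs_nonneg _)).1 g1, (Real.log_pos_iff (abs_nonneg _)).1 g2⟩
    · left
      exact ⟨(Real.log_neg_iff (abs_pos.2 (hp n))).1 g1, (Real.log_neg_iff (abs_pos.2 (hq n))).1 g2⟩
  · have h0 := hpos 0
    simp only [Function.iterate_zero, id] at h0 ⊢
    intro he
    rcases mul_pos_iff.1 h0 with ⟨g1, g2⟩ | ⟨g1, g2⟩
    · rw [abs_of_pos g1, abs_of_pos g2] at he; linarith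
    · rw [abs_of_neg g1, abs_of_neg g2] at he; linarith

/-- Two distinct extended reals cannot both be approached by the `Rset`s. -/
lemma no_gap {a : ℝ} (ha : 1 / 3 < a) (hla : -1 < Real.log a)
    (hae : a ≤ Real.exp 1) {ε : ℕ → Bool} {x y : EReal} (hxy : x < y)
    (h : ∀ p q : ℝ, x < (p : EReal) → p < q → (q : EReal) < y →
      ∀ n, (∃ P ∈ Rset a n ε, P < (p : EReal)) ∧ ∃ Q ∈ Rset a n ε, (q : EReal) < Q) : False := by
  obtain ⟨p, hp1, hp2⟩ := EReal.lt_iff_exists_real_btwn.1 hxy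
  obtain ⟨q, hq1, hq2⟩ := EReal.lt_iff_exists_real_btwn.1 hp2
  have hpq : p < q := by exact_mod_cast hq1
  refine BtwR.false ha hla hae (ε := ε) hpq ?_
  intro n
  obtain ⟨⟨P, hP, hPp⟩, Q, hQ, hQq⟩ := h p q hp1 hpq hq2 n
  exact ⟨P, hP, Q, hQ, hPp, hPp.trans hq1, hq1.trans hQq, hQq⟩

lemma conv_all {a : ℝ} (ha : 1 / 3 < a) (hla : -1 < Real.log a)
    (hae : a ≤ Real.exp 1) (ε : ℕ → Bool) : ∃ t : EReal, Represents a ε t := by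
  refine ⟨limsup (fun n => uSeq a n ε) atTop, ?_⟩
  refine tendsto_of_liminf_eq_limsup ?_ rfl
  by_contra hne
  have hlt : liminf (fun n => uSeq a n ε) atTop < limsup (fun n => uSeq a n ε) atTop :=
    lt_of_le_of_ne (liminf_le_limsup) hne
  refine no_gap ha hla hae (ε := ε) hlt ?_
  intro p q hp hpq hq n
  constructor
  · have := frequently_lt_of_liminf_lt (by isBoundedDefault) hp
    obtain ⟨m, hm, h⟩ := (frequently_atTop.1 this) n
    exact ⟨_, uSeq_mem a n ε m hm, h⟩
  · have := frequently_lt_of_lt_limsup (by isBoundedDefault) hq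
    obtain ⟨m, hm, h⟩ := (frequently_atTop.1 this) n
    exact ⟨_, uSeq_mem a n ε m hm, h⟩

lemma exists_code {a : ℝ} (ha : 0 < a) (t : EReal) : ∃ ε : ℕ → Bool, ∀ n, t ∈ Rset a n ε := by
  choose s g hsg using fun t => fSgn_surj ha t
  have key : ∀ n t, t ∈ Rset a n (fun k => s (g^[k] t)) := by
    intro n
    induction n with
    | zero => intro t; exact Set.mem_univ _
    | succ n ih =>
      intro t
      refine ⟨g t, ?_, (hsg t).symm⟩
      have := ih (g t)
      simpa only [Function.iterate_succ_apply] using this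
  exact ⟨_, fun n => key n t⟩

/-- If `A ∈ (0,1)` satisfies `(A+1)·A^{-1/(A+1)} = e`, then every `a` with
`A < a ≤ e` is suitable. -/
theorem suitable_of_mem_Ioc_A_e (A : ℝ) (hA : A ∈ Set.Ioo (0 : ℝ) 1)
    (hAeq : (A + 1) * Real.rpow A (-1 / (A + 1)) = Real.exp 1)
    (a : ℝ) (haA : A < a) (hae : a ≤ Real.exp 1) :
    (∀ ε : ℕ → Bool, ∃ t : EReal, Represents a ε t) ∧
      ∀ t : EReal, Representable a t := by
  have ha0 : 0 < a := hA.1.trans haA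
  have hla : -1 < Real.log a :=
    (log_A_gt A hA hAeq).trans (Real.log_lt_log hA.1 haA)
  have ha : 1 / 3 < a := by
    have h1 : Real.exp (-1) < a := (Real.lt_log_iff_exp_lt ha0).1 hla
    have h2 : Real.exp 1 < 3 := by have := Real.exp_one_lt_d9; linarith
    have h3 : 1 / 3 < Real.exp (-1) := by
      rw [Real.exp_neg, ← one_div]
      exact one_div_lt_one_div_of_lt (Real.exp_pos 1) h2
    linarith
  refine ⟨conv_all ha hla hae, fun t => ?_⟩
  obtain ⟨ε, hε⟩ := exists_code ha0 t
  obtain ⟨s, hs⟩ := conv_all ha hla hae ε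
  refine ⟨ε, ?_⟩
  have hst : s = t := by
    by_contra hne
    rcases lt_or_gt_of_ne hne with h | h
    · refine no_gap ha hla hae (ε := ε) h ?_
      intro p q hp hpq hq n
      obtain ⟨m, hm⟩ := ((hs.eventually (gt_mem_nhds hp)).and (eventually_ge_atTop n)).exists
      exact ⟨⟨_, uSeq_mem a n ε m hm.2, hm.1⟩, t, hε n, hq⟩
    · refine no_gap ha hla hae (ε := ε) h ?_
      intro p q hp hpq hq n
      obtain ⟨m, hm⟩ := ((hs.eventually (lt_mem_nhds hq)).and (eventually_ge_atTop n)).exists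
      exact ⟨⟨t, hε n, hp⟩, _, uSeq_mem a n ε m hm.2, hm.1⟩
  rw [← hst]
  exact hs
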